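/- For every natural number N and every x ∈ R: (−1)^N · Σ_{k=0}^{N} [N,k]_q · (−x)^k = Σ_{k=0}^{⌊N/2⌋} [N,2k]_q · (∏_{i=0}^{N−2k−1}(x − q^i)) · (∏_{j=0}^{k−1}(1 − q^{2j+1})). -/

import Mathlib

/-- The Gaussian (`q`-binomial) coefficient `[n, k]_q`, defined by the recurrence
`[n, 0]_q = 1`, `[0, k+1]_q = 0`, `[n+1, k+1]_q = [n, k]_q + q^(k+1) * [n, k+1]_q`
(so that `[n+1, k]_q = [n, k-1]_q + q^k * [n, k]_q` and `[n, k]_q = 0` for `k > n`). -/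
def qBinom {R : Type*} [CommRing R] (q : R) : ℕ → ℕ → R
  | _, 0 => 1
  | 0, _ + 1 => 0
  | n + 1, k + 1 => qBinom q n k + q ^ (k + 1) * qBinom q n (k + 1)

section GaussianBinomial

variable {R : Type*} [CommRing R] (q : R)

theorem qBinom_zero_right (n : ℕ) : qBinom q n 0 = 1 := by
  cases n <;> rfl

theorem qBinom_succ_succ (n k : ℕ) :
    qBinom q (n + 1) (k + 1) = qBinom q n k + q ^ (k + 1) * qBinom q n (k + 1) := rfl

theorem qBinom_eq_zero_of_lt {n k : ℕ} (h : n < k) : qBinom q n k = 0 := by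
  induction n generalizing k with
  | zero =>
    obtain ⟨k, rfl⟩ := Nat.exists_eq_add_of_lt h
    simp [qBinom]
  | succ n ih =>
    cases k with
    | zero => omega
    | succ k => rw [qBinom_succ_succ, ih (by omega), ih (by omega)]; ring

theorem qBinom_self (n : ℕ) : qBinom q n n = 1 := by
  induction n with
  | zero => rfl
  | succ n ih => rw [qBinom_succ_succ, ih, qBinom_eq_zero_of_lt q n.lt_succ_self]; ring

/-- The second `q`-Pascal rule. -/
theorem qBinom_succ_succ' {n m k : ℕ} (h : n = m + k) :
    qBinom q (n + 1) (k + 1) = q ^ m * qBinom q n k + qBinom q n (k + 1) := by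
  induction n generalizing m k with
  | zero =>
    obtain ⟨rfl, rfl⟩ : m = 0 ∧ k = 0 := by omega
    simp [qBinom]
  | succ n ih =>
    rcases m with _ | m
    · obtain rfl : k = n + 1 := by omega
      rw [qBinom_self, qBinom_self, qBinom_eq_zero_of_lt q (Nat.lt_succ_self _)]
      ring
    · rcases k with _ | k
      · have e := ih (m := n) (k := 0) rfl
        obtain rfl : m = n := by omega
        have e' := qBinom_succ_succ q m 0
        rw [qBinom_succ_succ q (m + 1) 0]
        simp only [qBinom_zero_right] at *
        linear_combination q * e - e'
      · have e₁ := ih (m := m + 1) (k := k) (by omega)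
        have e₂ := ih (m := m) (k := k + 1) (by omega)
        have e₃ := qBinom_succ_succ q n k
        have e₄ := qBinom_succ_succ q n (k + 1)
        rw [qBinom_succ_succ q (n + 1) (k + 1)]
        linear_combination e₁ + q ^ (k + 2) * e₂ - q ^ (m + 1) * e₃ - e₄

theorem one_sub_pow_mul_qBinom_succ_right {n m k : ℕ} (h : n = m + k) :
    (1 - q ^ (k + 1)) * qBinom q n (k + 1) = (1 - q ^ m) * qBinom q n k := by
  linear_combination qBinom_succ_succ q n k - qBinom_succ_succ' q h

theorem one_sub_pow_mul_qBinom_succ_succ (n k : ℕ) :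
    (1 - q ^ (k + 1)) * qBinom q (n + 1) (k + 1) = (1 - q ^ (n + 1)) * qBinom q n k := by
  rcases lt_or_ge n k with h | h
  · rw [qBinom_eq_zero_of_lt q h, qBinom_eq_zero_of_lt q (Nat.succ_lt_succ h)]; ring
  · obtain ⟨m, rfl⟩ := Nat.exists_eq_add_of_le' h
    linear_combination (1 - q ^ (k + 1)) * qBinom_succ_succ' q (rfl : m + k = m + k) +
      one_sub_pow_mul_qBinom_succ_right q (rfl : m + k = m + k)

theorem one_sub_pow_mul_qBinom_succ_left {n m k : ℕ} (h : n + 1 = m + k) :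
    (1 - q ^ m) * qBinom q (n + 1) k = (1 - q ^ (n + 1)) * qBinom q n k := by
  rw [← one_sub_pow_mul_qBinom_succ_right q h, one_sub_pow_mul_qBinom_succ_succ]

/-- The three-term recurrence of the Rogers–Szegő polynomials. -/
theorem sum_qBinom_mul_pow_add_two (y : R) (N : ℕ) :
    ∑ k ∈ Finset.range (N + 3), qBinom q (N + 2) k * y ^ k =
      (1 + y) * ∑ k ∈ Finset.range (N + 2), qBinom q (N + 1) k * y ^ k -
        (1 - q ^ (N + 1)) * y * ∑ k ∈ Finset.range (N + 1), qBinom q N k * y ^ k := by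
  have h₁ : ∑ k ∈ Finset.range (N + 2), qBinom q (N + 1) k * y ^ k =
      ∑ k ∈ Finset.range (N + 2), qBinom q (N + 1) (k + 1) * y ^ (k + 1) + 1 := by
    have e := Finset.sum_range_succ (fun k ↦ qBinom q (N + 1) k * y ^ k) (N + 2)
    rw [Finset.sum_range_succ'] at e
    simpa [qBinom_zero_right, qBinom_eq_zero_of_lt q (Nat.lt_succ_self (N + 1))] using e.symm
  have h₂ : ∑ k ∈ Finset.range (N + 1), qBinom q N k * y ^ k =
      ∑ k ∈ Finset.range (N + 2), qBinom q N k * y ^ k := by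
    rw [Finset.sum_range_succ _ (N + 1), qBinom_eq_zero_of_lt q N.lt_succ_self]; ring
  rw [add_mul, one_mul, h₂]
  nth_rewrite 1 [h₁]
  rw [Finset.sum_range_succ', Finset.mul_sum, Finset.mul_sum, add_right_comm, add_sub_right_comm,
    ← Finset.sum_add_distrib, ← Finset.sum_sub_distrib]
  simp only [qBinom_zero_right, pow_zero, mul_one]
  congr 1
  refine Finset.sum_congr rfl fun k hk ↦ ?_
  obtain ⟨m, hm⟩ := Nat.exists_eq_add_of_le' (Nat.lt_succ_iff.mp (Finset.mem_range.mp hk))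
  linear_combination y ^ (k + 1) * qBinom_succ_succ' q hm -
    y ^ (k + 1) * one_sub_pow_mul_qBinom_succ_left q hm

/-- The `k`-th summand on the right-hand side of Gauss's formula. -/
def gaussSummand (x : R) (N k : ℕ) : R :=
  qBinom q N (2 * k) * (∏ i ∈ Finset.range (N - 2 * k), (x - q ^ i)) *
    (∏ j ∈ Finset.range k, (1 - q ^ (2 * j + 1)))

theorem sum_gaussSummand_eq_of_le (x : R) {N M : ℕ} (h : N / 2 + 1 ≤ M) :
    ∑ k ∈ Finset.range (N / 2 + 1), gaussSummand q x N k =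
      ∑ k ∈ Finset.range M, gaussSummand q x N k := by
  refine Finset.sum_subset (Finset.range_mono h) fun k _ hk ↦ ?_
  rw [Finset.mem_range] at hk
  rw [gaussSummand, qBinom_eq_zero_of_lt q (by omega)]
  ring

theorem sub_one_mul_gaussSummand_succ (x : R) (N k : ℕ) :
    (x - 1) * gaussSummand q x (N + 1) k =
      qBinom q (N + 1) (2 * k) * (∏ i ∈ Finset.range (N + 2 - 2 * k), (x - q ^ i)) *
        (∏ j ∈ Finset.range k, (1 - q ^ (2 * j + 1))) -
      (1 - q ^ (N + 1)) * qBinom q N (2 * k) *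
        (∏ i ∈ Finset.range (N + 1 - 2 * k), (x - q ^ i)) *
        (∏ j ∈ Finset.range k, (1 - q ^ (2 * j + 1))) := by
  rw [gaussSummand]
  rcases lt_or_ge (N + 1) (2 * k) with h | h
  · rw [qBinom_eq_zero_of_lt q h, qBinom_eq_zero_of_lt q (N.lt_succ_self.trans h)]; ring
  · obtain ⟨m, hm⟩ := Nat.exists_eq_add_of_le' h
    rw [← one_sub_pow_mul_qBinom_succ_left q hm, show N + 2 - 2 * k = m + 1 by omega,
      show N + 1 - 2 * k = m by omega, Finset.prod_range_succ]
    ring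

theorem mul_gaussSummand (x : R) (N k : ℕ) :
    (1 - q ^ (N + 1)) * x * gaussSummand q x N k =
      (1 - q ^ (N + 1)) * qBinom q N (2 * k) *
        (∏ i ∈ Finset.range (N + 1 - 2 * k), (x - q ^ i)) *
        (∏ j ∈ Finset.range k, (1 - q ^ (2 * j + 1))) +
      q ^ (N - 2 * k) * qBinom q (N + 1) (2 * k + 1) *
        (∏ i ∈ Finset.range (N - 2 * k), (x - q ^ i)) *
        (∏ j ∈ Finset.range (k + 1), (1 - q ^ (2 * j + 1))) := by
  rw [gaussSummand]
  rcases lt_or_ge N (2 * k) with h | h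
  · rw [qBinom_eq_zero_of_lt q h, qBinom_eq_zero_of_lt q (Nat.succ_lt_succ h)]; ring
  · obtain ⟨m, hm⟩ := Nat.exists_eq_add_of_le' h
    rw [show N + 1 - 2 * k = m + 1 by omega, show N - 2 * k = m by omega,
      Finset.prod_range_succ, Finset.prod_range_succ]
    linear_combination -q ^ m * (∏ i ∈ Finset.range m, (x - q ^ i)) *
      (∏ j ∈ Finset.range k, (1 - q ^ (2 * j + 1))) *
      one_sub_pow_mul_qBinom_succ_succ q N (2 * k)

theorem gaussSummand_add_two_succ (x : R) (N k : ℕ) :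
    gaussSummand q x (N + 2) (k + 1) =
      qBinom q (N + 1) (2 * (k + 1)) *
        (∏ i ∈ Finset.range (N + 2 - 2 * (k + 1)), (x - q ^ i)) *
        (∏ j ∈ Finset.range (k + 1), (1 - q ^ (2 * j + 1))) +
      q ^ (N - 2 * k) * qBinom q (N + 1) (2 * k + 1) *
        (∏ i ∈ Finset.range (N - 2 * k), (x - q ^ i)) *
        (∏ j ∈ Finset.range (k + 1), (1 - q ^ (2 * j + 1))) := by
  rw [gaussSummand, show N + 2 - 2 * (k + 1) = N - 2 * k by omega,
    show 2 * (k + 1) = 2 * k + 1 + 1 by ring]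
  rcases lt_or_ge N (2 * k) with h | h
  · rw [qBinom_eq_zero_of_lt q (show N + 2 < 2 * k + 1 + 1 by omega),
      qBinom_eq_zero_of_lt q (show N + 1 < 2 * k + 1 + 1 by omega),
      qBinom_eq_zero_of_lt q (show N + 1 < 2 * k + 1 by omega)]
    ring
  · rw [qBinom_succ_succ' q (show N + 1 = N - 2 * k + (2 * k + 1) by omega)]
    ring

theorem sum_gaussSummand_add_two (x : R) (N : ℕ) :
    ∑ k ∈ Finset.range ((N + 2) / 2 + 1), gaussSummand q x (N + 2) k =
      (x - 1) * ∑ k ∈ Finset.range ((N + 1) / 2 + 1), gaussSummand q x (N + 1) k +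
        (1 - q ^ (N + 1)) * x * ∑ k ∈ Finset.range (N / 2 + 1), gaussSummand q x N k := by
  rw [sum_gaussSummand_eq_of_le q x (show (N + 2) / 2 + 1 ≤ N + 2 + 1 by omega),
    sum_gaussSummand_eq_of_le q x (show (N + 1) / 2 + 1 ≤ N + 2 by omega),
    sum_gaussSummand_eq_of_le q x (show N / 2 + 1 ≤ N + 2 by omega),
    Finset.mul_sum, Finset.mul_sum, Finset.sum_range_succ']
  simp only [sub_one_mul_gaussSummand_succ, mul_gaussSummand, gaussSummand_add_two_succ,
    Finset.sum_add_distrib, Finset.sum_sub_distrib]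
  set w : ℕ → R := fun k ↦ qBinom q (N + 1) (2 * k) *
    (∏ i ∈ Finset.range (N + 2 - 2 * k), (x - q ^ i)) *
    (∏ j ∈ Finset.range k, (1 - q ^ (2 * j + 1))) with hw
  have e := Finset.sum_range_succ w (N + 2)
  rw [Finset.sum_range_succ'] at e
  have hlast : w (N + 2) = 0 := by
    simp [hw, qBinom_eq_zero_of_lt q (show N + 1 < 2 * (N + 2) by omega)]
  have hfirst : gaussSummand q x (N + 2) 0 = w 0 := by
    simp [hw, gaussSummand, qBinom_zero_right]
  rw [hfirst]
  linear_combination e + hlast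

end GaussianBinomial

/-- Formula (3.14): for all `N` and `x`,
`(-1)^N ∑_{k=0}^{N} [N,k]_q (-x)^k
  = ∑_{k=0}^{⌊N/2⌋} [N,2k]_q (x ∸ 1)^{N-2k} (q; q²)_k`. -/
theorem gauss_main_formula' {R : Type*} [CommRing R] (q : R) (N : ℕ) (x : R) :
    (-1) ^ N * ∑ k ∈ Finset.range (N + 1), qBinom q N k * (-x) ^ k =
      ∑ k ∈ Finset.range (N / 2 + 1),
        qBinom q N (2 * k) *
          (∏ i ∈ Finset.range (N - 2 * k), (x - q ^ i)) *
          (∏ j ∈ Finset.range k, (1 - q ^ (2 * j + 1))) := by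
  change _ = ∑ k ∈ Finset.range (N / 2 + 1), gaussSummand q x N k
  induction N using Nat.twoStepInduction with
  | zero => simp [gaussSummand, qBinom]
  | one => simp [gaussSummand, qBinom, Finset.sum_range_succ, ← sub_eq_add_neg]
  | more N ih₀ ih₁ =>
    rw [sum_gaussSummand_add_two, ← ih₀, ← ih₁, sum_qBinom_mul_pow_add_two]
    ring
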